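/- Let k be a positive integer and let M, N be nonnegative integers. Then for every real number x, sin(x) · ∑_{l ∈ ℤ} C(M+N, M−kl) · C(M+N, N−kl) · sin(|l|·x) ≥ 0. Equivalently, ∑_{l} C(M+N, M−kl) C(M+N, N−kl) · sin(|l|x)/sin(x) ≥ 0 wherever sin(x) ≠ 0. -/

import Mathlib

/-- Binomial coefficient `C(n, b)` with integer lower index, zero unless `0 ≤ b ≤ n`. -/
def zchoose (n : ℕ) (b : ℤ) : ℕ := if 0 ≤ b then n.choose b.toNat else 0

open LaurentPolynomial in
/-- The Laurent polynomial `T ^ a + T ^ (-a)`. -/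
noncomputable def symT (a : ℤ) : LaurentPolynomial ℝ := T a + T (-a)

theorem symT_zero : symT 0 = 2 := by
  simp only [symT, neg_zero, LaurentPolynomial.T_zero]; norm_num

theorem symT_mul (a b : ℤ) : symT a * symT b = symT (a + b) + symT (a - b) := by
  simp only [symT, mul_add, add_mul, ← LaurentPolynomial.T_add]
  rw [show -(a + b) = -a + -b by ring, show -(a - b) = -a + b by ring, sub_eq_add_neg]
  ring

/-- The linear functional on Laurent polynomials sending `T ^ i` to `w i`. -/
noncomputable def weightedSum (w : ℤ → ℝ) : LaurentPolynomial ℝ →ₗ[ℝ] ℝ :=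
  (Finsupp.linearCombination ℝ w).comp (AddMonoidAlgebra.coeffLinearEquiv ℝ).toLinearMap

theorem weightedSum_T (w : ℤ → ℝ) (i : ℤ) : weightedSum w (LaurentPolynomial.T i) = w i := by
  simp [weightedSum, LaurentPolynomial.T, -LaurentPolynomial.single_eq_C_mul_T]

theorem LaurentPolynomial.linearMap_ext {φ ψ : LaurentPolynomial ℝ →ₗ[ℝ] ℝ}
    (h : ∀ i, φ (T i) = ψ (T i)) : φ = ψ := by
  refine LinearMap.ext fun q => ?_
  induction q using LaurentPolynomial.induction_on' with
  | add p q hp hq => rw [map_add, map_add, hp, hq]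
  | C_mul_T n a => rw [← LaurentPolynomial.smul_eq_C_mul, map_smul, map_smul, h]

/-- A functional that is nonnegative on the products `symT k ^ m * symT a` with `a < k` is
nonnegative on their products with powers of `symT 1`. -/
theorem nonneg_symT_one_pow_mul {φ : LaurentPolynomial ℝ →ₗ[ℝ] ℝ} {k : ℕ} (hk : 0 < k)
    (h : ∀ m a : ℕ, a < k → 0 ≤ φ (symT k ^ m * symT a)) (n m a : ℕ) (ha : a < k) :
    0 ≤ φ (symT 1 ^ n * (symT k ^ m * symT a)) := by
  induction n generalizing m a with
  | zero => simpa using h m a ha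
  | succ n ih =>
    have top : ∀ m b : ℕ, b ≤ k → 0 ≤ φ (symT 1 ^ n * (symT k ^ m * symT b)) := by
      intro m b hb
      rcases hb.lt_or_eq with hb | rfl
      · exact ih m b hb
      · have := ih (m + 1) 0 hk
        rw [Nat.cast_zero, symT_zero, show symT 1 ^ n * (symT b ^ (m + 1) * 2)
          = (2 : ℝ) • (symT 1 ^ n * (symT b ^ m * symT b)) by rw [two_smul]; ring, map_smul,
          smul_eq_mul] at this
        linarith
    rcases a with _ | a
    · have := top m 1 hk
      rw [Nat.cast_zero, symT_zero, show symT 1 ^ (n + 1) * (symT k ^ m * 2)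
          = (2 : ℝ) • (symT 1 ^ n * (symT k ^ m * symT (1 : ℕ))) by
            rw [two_smul, Nat.cast_one]; ring, map_smul, smul_eq_mul]
      linarith
    · have e : symT 1 ^ (n + 1) * (symT k ^ m * symT (a + 1 : ℕ))
          = symT 1 ^ n * (symT k ^ m * symT (a + 2 : ℕ))
            + symT 1 ^ n * (symT k ^ m * symT (a : ℕ)) := by
        have := symT_mul (a + 1 : ℕ) 1
        rw [show ((a + 1 : ℕ) : ℤ) + 1 = (a + 2 : ℕ) by push_cast; ring,
          show ((a + 1 : ℕ) : ℤ) - 1 = (a : ℕ) by push_cast; ring] at this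
        rw [← mul_add, ← mul_add, ← this]
        ring
      rw [e, map_add]
      exact add_nonneg (top m _ ha) (ih m a (by omega))

open Polynomial in
theorem nonneg_coeff_trinomial_pow {R : Type*} [CommRing R] [Algebra ℝ R] {φ : R →ₗ[ℝ] ℝ} {t : R}
    (h : ∀ j : ℕ, 0 ≤ φ (t ^ j)) (n d j : ℕ) :
    0 ≤ φ (t ^ j * ((1 + C t * X + X ^ 2) ^ n).coeff d) := by
  induction n generalizing d j with
  | zero =>
    rw [pow_zero, coeff_one]
    split_ifs
    · simpa using h j
    · simp
  | succ n ih =>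
    rw [show (1 + C t * X + X ^ 2) ^ (n + 1) = (1 + C t * X + X ^ 2 : R[X]) ^ n
      + C t * ((1 + C t * X + X ^ 2) ^ n * X) + (1 + C t * X + X ^ 2) ^ n * X ^ 2 by ring]
    have lin : ∀ d, 0 ≤ φ (t ^ j * (t * ((1 + C t * X + X ^ 2) ^ n).coeff d)) := fun d => by
      rw [← mul_assoc, ← pow_succ]; exact ih d (j + 1)
    rw [coeff_add, coeff_add, coeff_C_mul, mul_add, mul_add, map_add, map_add]
    refine add_nonneg (add_nonneg (ih d j) ?_) ?_
    · rcases d with _ | d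
      · simp
      · rw [coeff_mul_X]; exact lin d
    · rw [coeff_mul_X_pow']
      split_ifs
      · exact ih _ j
      · simp

open Polynomial in
theorem coeff_one_add_C_mul_X_pow {R : Type*} [CommRing R] (r : R) (n i : ℕ) :
    ((1 + C r * X) ^ n).coeff i = n.choose i * r ^ i := by
  have : (1 + C r * X) ^ n = ((1 + X : R[X]) ^ n).comp (C r * X) := by simp
  rw [this, comp_C_mul_X_coeff, coeff_one_add_X_pow]

open Polynomial in
theorem coeff_symT_trinomial_pow (n d : ℕ) :
    ((1 + C (symT 1) * X + X ^ 2) ^ n).coeff d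
      = ∑ p ∈ Finset.HasAntidiagonal.antidiagonal d,
        ((n.choose p.1 : ℝ) * n.choose p.2) • LaurentPolynomial.T ((p.1 : ℤ) - p.2) := by
  have e : (1 + C (symT 1) * X + X ^ 2)
      = (1 + C (LaurentPolynomial.T 1) * X) * (1 + C (LaurentPolynomial.T (-1) :
        LaurentPolynomial ℝ) * X) := by
    have : (C (LaurentPolynomial.T 1) * C (LaurentPolynomial.T (-1)) :
        (LaurentPolynomial ℝ)[X]) = 1 := by
      rw [← C_mul, ← LaurentPolynomial.T_add]; simp
    rw [symT, C_add]
    linear_combination (-X ^ 2) * this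
  rw [e, mul_pow, coeff_mul]
  refine Finset.sum_congr rfl fun p _ => ?_
  rw [coeff_one_add_C_mul_X_pow, coeff_one_add_C_mul_X_pow, LaurentPolynomial.T_pow,
    LaurentPolynomial.T_pow, sub_eq_add_neg, LaurentPolynomial.T_add, Algebra.smul_def]
  simp only [mul_one, mul_neg_one, map_mul, map_natCast]
  ring

/-- The weight `sin x * sin (|l| x)` at `i = 2 k l`, and zero at non-multiples of `2 k`. -/
noncomputable def sineWeight (k : ℕ) (x : ℝ) (i : ℤ) : ℝ :=
  if (2 * k : ℤ) ∣ i then Real.sin x * Real.sin (((i / (2 * k)).natAbs : ℝ) * x) else 0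

theorem sineWeight_mul {k : ℕ} (hk : 0 < k) (x : ℝ) (l : ℤ) :
    sineWeight k x (2 * k * l) = Real.sin x * Real.sin ((l.natAbs : ℝ) * x) := by
  have : (2 * k : ℤ) ≠ 0 := by positivity
  rw [sineWeight, if_pos (dvd_mul_right _ _), Int.mul_ediv_cancel_left _ this]

theorem sineWeight_of_not_dvd {k : ℕ} (x : ℝ) {i : ℤ} (h : ¬ (2 * k : ℤ) ∣ i) :
    sineWeight k x i = 0 := if_neg h

theorem sin_natAbs_add_one_add_sin_natAbs_sub_one (l : ℤ) (x : ℝ) :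
    Real.sin (((l + 1).natAbs : ℝ) * x) + Real.sin (((l - 1).natAbs : ℝ) * x)
      = 2 * Real.cos x * Real.sin ((l.natAbs : ℝ) * x)
        + if l = 0 then 2 * Real.sin x else 0 := by
  simp only [Nat.cast_natAbs, Int.cast_abs, Int.cast_add, Int.cast_sub, Int.cast_one]
  rcases lt_trichotomy l 0 with h | rfl | h
  · have h' : (l : ℝ) + 1 ≤ 0 := by exact_mod_cast h
    rw [abs_of_nonpos h', abs_of_nonpos (by linarith), abs_of_nonpos (by linarith), if_neg h.ne,
      show -((l : ℝ) + 1) * x = -l * x - x by ring, show -((l : ℝ) - 1) * x = -l * x + x by ring,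
      Real.sin_add, Real.sin_sub]
    ring
  · simp; ring
  · have h' : (1 : ℝ) ≤ l := by exact_mod_cast h
    rw [abs_of_nonneg (by linarith), abs_of_nonneg (by linarith), abs_of_nonneg (by linarith),
      if_neg h.ne', add_mul, sub_mul, one_mul, Real.sin_add, Real.sin_sub]
    ring

theorem sineWeight_add_sub {k : ℕ} (hk : 0 < k) (x : ℝ) (i : ℤ) :
    sineWeight k x (i + 2 * k) + sineWeight k x (i - 2 * k)
      = 2 * Real.cos x * sineWeight k x i
        + 2 * Real.sin x ^ 2 * (Pi.single 0 1 : ℤ → ℝ) i := by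
  by_cases h : (2 * k : ℤ) ∣ i
  · obtain ⟨l, rfl⟩ := h
    rw [show (2 * k * l + 2 * k : ℤ) = 2 * k * (l + 1) by ring,
      show (2 * k * l - 2 * k : ℤ) = 2 * k * (l - 1) by ring, sineWeight_mul hk,
      sineWeight_mul hk, sineWeight_mul hk, ← mul_add,
      sin_natAbs_add_one_add_sin_natAbs_sub_one, Pi.single_apply]
    have : (2 * k * l : ℤ) = 0 ↔ l = 0 := by simp [hk.ne']
    simp only [this]
    split_ifs <;> ring
  · have h0 : i ≠ 0 := by rintro rfl; simp at h
    rw [sineWeight_of_not_dvd x h, sineWeight_of_not_dvd x (by simpa using h),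
      sineWeight_of_not_dvd x (by simpa using h), Pi.single_eq_of_ne h0]
    simp

theorem weightedSum_sineWeight_symT_mul {k : ℕ} (hk : 0 < k) (x : ℝ) (q : LaurentPolynomial ℝ) :
    weightedSum (sineWeight k x) (symT (2 * k) * q)
      = 2 * Real.cos x * weightedSum (sineWeight k x) q
        + 2 * Real.sin x ^ 2 * weightedSum (Pi.single 0 1) q := by
  have : (weightedSum (sineWeight k x)).comp (LinearMap.mulLeft ℝ (symT (2 * k)))
      = (2 * Real.cos x) • weightedSum (sineWeight k x)
        + (2 * Real.sin x ^ 2) • weightedSum (Pi.single 0 1) := by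
    refine LaurentPolynomial.linearMap_ext fun i => ?_
    simp only [LinearMap.comp_apply, LinearMap.mulLeft_apply, LinearMap.add_apply,
      LinearMap.smul_apply, weightedSum_T, smul_eq_mul, symT, add_mul, ← LaurentPolynomial.T_add,
      map_add]
    rw [← sineWeight_add_sub hk, add_comm (2 * k : ℤ), neg_add_eq_sub]
  exact LinearMap.congr_fun this q

theorem T_mul_symT_pow_succ (b a : ℤ) (m : ℕ) :
    LaurentPolynomial.T b * symT a ^ (m + 1)
      = LaurentPolynomial.T (b + a) * symT a ^ m
        + LaurentPolynomial.T (b - a) * symT a ^ m := by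
  rw [LaurentPolynomial.T_add, sub_eq_add_neg, LaurentPolynomial.T_add, symT]
  ring

theorem weightedSum_T_mul_symT_pow_nonneg {w : ℤ → ℝ} (hw : ∀ i, 0 ≤ w i) (a b : ℤ) (m : ℕ) :
    0 ≤ weightedSum w (LaurentPolynomial.T b * symT a ^ m) := by
  induction m generalizing b with
  | zero => rw [pow_zero, mul_one, weightedSum_T]; exact hw b
  | succ m ih => rw [T_mul_symT_pow_succ, map_add]; exact add_nonneg (ih _) (ih _)

theorem weightedSum_T_mul_symT_pow_eq_zero {w : ℤ → ℝ} {a : ℤ} (hw : ∀ i, ¬ a ∣ i → w i = 0)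
    {b : ℤ} (hb : ¬ a ∣ b) (m : ℕ) :
    weightedSum w (LaurentPolynomial.T b * symT a ^ m) = 0 := by
  induction m generalizing b with
  | zero => rw [pow_zero, mul_one, weightedSum_T]; exact hw b hb
  | succ m ih =>
    rw [T_mul_symT_pow_succ, map_add, ih (by simpa using hb), ih (by simpa using hb), add_zero]

theorem weightedSum_sineWeight_symT_pow_nonneg {k : ℕ} (hk : 0 < k) (x : ℝ) (m : ℕ) :
    0 ≤ weightedSum (sineWeight k x) (symT k ^ m) := by
  induction m using Nat.twoStepInduction with
  | zero =>
    rw [pow_zero, ← LaurentPolynomial.T_zero, weightedSum_T]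
    simpa using (sineWeight_mul hk x 0).ge
  | one =>
    have h : ¬ (2 * k : ℤ) ∣ k := fun h => by
      have := Int.le_of_dvd (by exact_mod_cast hk) h
      omega
    rw [pow_one, symT, map_add, weightedSum_T, weightedSum_T, sineWeight_of_not_dvd x h,
      sineWeight_of_not_dvd x (by simpa using h), add_zero]
  | more m ih _ =>
    have e : symT k ^ (m + 2) = symT (2 * k) * symT k ^ m + (2 : ℝ) • symT k ^ m := by
      have := symT_mul k k
      rw [sub_self, symT_zero, ← two_mul] at this
      rw [two_smul]
      linear_combination symT k ^ m * this
    have hc : 0 ≤ weightedSum (Pi.single 0 1) (symT k ^ m) := by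
      have := weightedSum_T_mul_symT_pow_nonneg (w := Pi.single 0 1)
        (fun i => by rw [Pi.single_apply]; split_ifs <;> norm_num) k 0 m
      rwa [LaurentPolynomial.T_zero, one_mul] at this
    rw [e, map_add, map_smul, smul_eq_mul, weightedSum_sineWeight_symT_mul hk]
    have := mul_nonneg (by linarith [Real.neg_one_le_cos x] : 0 ≤ 2 * Real.cos x + 2) ih
    have := mul_nonneg (sq_nonneg (Real.sin x)) hc
    linarith

theorem weightedSum_sineWeight_symT_pow_mul_symT_nonneg {k : ℕ} (hk : 0 < k) (x : ℝ) (m a : ℕ)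
    (ha : a < k) : 0 ≤ weightedSum (sineWeight k x) (symT k ^ m * symT a) := by
  rcases a.eq_zero_or_pos with rfl | h
  · rw [Nat.cast_zero, symT_zero, mul_two, map_add]
    have := weightedSum_sineWeight_symT_pow_nonneg hk x m
    exact add_nonneg this this
  · have hb : ¬ (k : ℤ) ∣ a := fun h => by
      have := Int.le_of_dvd (by omega) h
      omega
    have hw : ∀ i, ¬ (k : ℤ) ∣ i → sineWeight k x i = 0 := fun i hi =>
      sineWeight_of_not_dvd x fun h => hi ((dvd_mul_left _ _).trans h)
    rw [mul_comm, symT, add_mul, map_add, weightedSum_T_mul_symT_pow_eq_zero hw hb,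
      weightedSum_T_mul_symT_pow_eq_zero hw (by simpa using hb), add_zero]

theorem sum_antidiagonal_choose_sineWeight_nonneg {k : ℕ} (hk : 0 < k) (x : ℝ) (n d : ℕ) :
    0 ≤ ∑ p ∈ Finset.HasAntidiagonal.antidiagonal d,
      (n.choose p.1 : ℝ) * n.choose p.2 * sineWeight k x ((p.1 : ℤ) - p.2) := by
  have hpow : ∀ j : ℕ, 0 ≤ weightedSum (sineWeight k x) (symT 1 ^ j) := fun j => by
    have := nonneg_symT_one_pow_mul hk
      (weightedSum_sineWeight_symT_pow_mul_symT_nonneg hk x) j 0 0 hk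
    rw [pow_zero, one_mul, Nat.cast_zero, symT_zero, mul_two, map_add] at this
    linarith
  have := nonneg_coeff_trinomial_pow hpow n d 0
  rw [pow_zero, one_mul, coeff_symT_trinomial_pow, map_sum] at this
  simpa only [map_smul, weightedSum_T, smul_eq_mul] using this

theorem zchoose_natCast (n b : ℕ) : zchoose n b = n.choose b := by
  simp [zchoose]

theorem zchoose_of_neg (n : ℕ) {b : ℤ} (h : b < 0) : zchoose n b = 0 :=
  if_neg h.not_ge

theorem zchoose_symm (n : ℕ) (b : ℤ) : zchoose n (n - b) = zchoose n b := by
  rcases lt_or_ge b 0 with h | h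
  · rw [zchoose_of_neg n h, zchoose, if_pos (by omega), Nat.choose_eq_zero_of_lt (by omega)]
  · lift b to ℕ using h
    rcases le_or_gt b n with h' | h'
    · rw [← Nat.cast_sub h', zchoose_natCast, zchoose_natCast, Nat.choose_symm h']
    · rw [zchoose_of_neg n (by omega), zchoose_natCast, Nat.choose_eq_zero_of_lt h']

theorem stmt18 (k M N : ℕ) (hk : 0 < k) (x : ℝ) :
    0 ≤ Real.sin x *
      ∑ l ∈ Finset.Icc (-((M : ℤ) + N)) ((M : ℤ) + N),
        (zchoose (M + N) ((M : ℤ) - k * l) : ℝ) *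
          (zchoose (M + N) ((N : ℤ) - k * l) : ℝ) * Real.sin ((l.natAbs : ℝ) * x) := by
  refine (sum_antidiagonal_choose_sineWeight_nonneg hk x (M + N) (2 * M)).trans_eq ?_
  rw [Finset.mul_sum]
  have hk' : (1 : ℤ) ≤ k := by exact_mod_cast hk
  refine Finset.sum_bij_ne_zero (fun p _ _ => ((p.1 : ℤ) - p.2) / (2 * k)) ?_ ?_ ?_ ?_
  · intro p hp h
    rw [Finset.HasAntidiagonal.mem_antidiagonal] at hp
    have hd : (2 * k : ℤ) ∣ (p.1 : ℤ) - p.2 := by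
      by_contra hd
      exact h (by rw [sineWeight_of_not_dvd x hd, mul_zero])
    obtain ⟨l, hl⟩ := hd
    rw [hl, Int.mul_ediv_cancel_left _ (by positivity), Finset.mem_Icc]
    constructor <;> nlinarith
  · intro p hp h q hq h' e
    rw [Finset.HasAntidiagonal.mem_antidiagonal] at hp hq
    have hd : (2 * k : ℤ) ∣ (p.1 : ℤ) - p.2 := by
      by_contra hd
      exact h (by rw [sineWeight_of_not_dvd x hd, mul_zero])
    have hd' : (2 * k : ℤ) ∣ (q.1 : ℤ) - q.2 := by
      by_contra hd
      exact h' (by rw [sineWeight_of_not_dvd x hd, mul_zero])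
    have := (Int.ediv_left_inj hd hd').1 e
    ext <;> omega
  · intro l _ h
    have h1 : 0 ≤ (M : ℤ) - k * l := by
      by_contra! h1
      exact h (by rw [zchoose_of_neg _ h1]; simp)
    have e : (N : ℤ) - k * l = (M + N : ℕ) - (M + k * l) := by push_cast; ring
    rw [e, zchoose_symm] at h
    have h2 : 0 ≤ (M : ℤ) + k * l := by
      by_contra! h2
      exact h (by rw [zchoose_of_neg _ h2]; simp)
    obtain ⟨b, hb⟩ := Int.eq_ofNat_of_zero_le h1
    obtain ⟨a, ha⟩ := Int.eq_ofNat_of_zero_le h2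
    have hab : (a : ℤ) - b = 2 * k * l := by rw [← ha, ← hb]; ring
    refine ⟨(a, b), by rw [Finset.HasAntidiagonal.mem_antidiagonal]; omega, ?_, ?_⟩
    · rw [hb, ha, zchoose_natCast, zchoose_natCast] at h
      rw [hab, sineWeight_mul hk]
      contrapose! h
      linear_combination h
    · simp only [hab]
      exact Int.mul_ediv_cancel_left _ (by positivity)
  · intro p hp h
    rw [Finset.HasAntidiagonal.mem_antidiagonal] at hp
    have hd : (2 * k : ℤ) ∣ (p.1 : ℤ) - p.2 := by
      by_contra hd
      exact h (by rw [sineWeight_of_not_dvd x hd, mul_zero])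
    obtain ⟨l, hl⟩ := hd
    have e : (N : ℤ) - k * l = (M + N : ℕ) - p.1 := by push_cast; linarith
    have e' : (M : ℤ) - k * l = p.2 := by linarith
    rw [hl, Int.mul_ediv_cancel_left _ (by positivity), sineWeight_mul hk, e, e', zchoose_symm,
      zchoose_natCast, zchoose_natCast]
    ring
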